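/- (Circularity condition.) Under the Kepler hypotheses with 𝐥 ≠ 0 and h < 0, the orbit is circular, i.e. ‖r(t)‖ = ‖r(0)‖ for all t, if and only if h = −m³k²/(2l²). -/

import Mathlib

open scoped RealInnerProductSpace

/-- Cross product on `EuclideanSpace ℝ (Fin 3)`. -/
noncomputable def cross3 (v w : EuclideanSpace ℝ (Fin 3)) : EuclideanSpace ℝ (Fin 3) :=
  (EuclideanSpace.equiv (Fin 3) ℝ).symm
    (crossProduct ((EuclideanSpace.equiv (Fin 3) ℝ) v) ((EuclideanSpace.equiv (Fin 3) ℝ) w))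

theorem norm_cross3_sq (v w : EuclideanSpace ℝ (Fin 3)) :
    ‖cross3 v w‖ ^ 2 = ‖v‖ ^ 2 * ‖w‖ ^ 2 - ⟪v, w⟫ ^ 2 := by
  simp only [EuclideanSpace.real_norm_sq_eq, PiLp.inner_apply, Fin.sum_univ_three, cross3,
    cross_apply, PiLp.continuousLinearEquiv_symm_apply, PiLp.coe_continuousLinearEquiv,
    EuclideanSpace.equiv, Matrix.cons_val, RCLike.inner_apply, conj_trivial]
  ring

section CentralForce

variable {E : Type*} [NormedAddCommGroup E] [InnerProductSpace ℝ E] {r v : ℝ → E}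

/-- Conservation of the squared angular momentum, expressed as a Gram determinant. -/
theorem gram_eq_of_central_force {c : ℝ → ℝ} (hr : ∀ t, HasDerivAt r (v t) t)
    (hv : ∀ t, HasDerivAt v (-(c t) • r t) t) (t s : ℝ) :
    ‖r t‖ ^ 2 * ‖v t‖ ^ 2 - ⟪r t, v t⟫ ^ 2 = ‖r s‖ ^ 2 * ‖v s‖ ^ 2 - ⟪r s, v s⟫ ^ 2 := by
  have key (t : ℝ) : HasDerivAt
      (fun t => ‖r t‖ ^ 2 * ‖v t‖ ^ 2 - ⟪r t, v t⟫ ^ 2) 0 t := by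
    refine (((hr t).norm_sq.mul (hv t).norm_sq).sub (((hr t).inner ℝ (hv t)).pow 2)).congr_deriv ?_
    simp only [inner_smul_right, real_inner_self_eq_norm_sq, real_inner_comm (r t) (v t)]
    push_cast
    ring
  exact is_const_of_deriv_eq_zero (fun t => (key t).differentiableAt) (fun t => (key t).deriv) t s

theorem kepler_energy_eq {k : ℝ} (hr : ∀ t, HasDerivAt r (v t) t) (hrne : ∀ t, r t ≠ 0)
    (hv : ∀ t, HasDerivAt v (-(k / ‖r t‖ ^ 3) • r t) t) (t s : ℝ) :
    ‖v t‖ ^ 2 / 2 - k / ‖r t‖ = ‖v s‖ ^ 2 / 2 - k / ‖r s‖ := by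
  have key (t : ℝ) : HasDerivAt (fun t => ‖v t‖ ^ 2 / 2 - k / ‖r t‖) 0 t := by
    have hpos : ‖r t‖ ≠ 0 := norm_ne_zero_iff.mpr (hrne t)
    have hnorm : HasDerivAt (fun t => ‖r t‖) (⟪r t, v t⟫ / ‖r t‖) t := by
      have := (hr t).norm_sq.sqrt (pow_ne_zero 2 hpos)
      simp only [Real.sqrt_sq (norm_nonneg _)] at this
      convert this using 1
      field_simp
    refine (((hv t).norm_sq.div_const 2).sub ((hasDerivAt_const t k).div hnorm hpos)).congr_deriv ?_
    simp only [inner_smul_right, real_inner_comm (r t) (v t)]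
    field_simp
    ring
  exact is_const_of_deriv_eq_zero (fun t => (key t).differentiableAt) (fun t => (key t).deriv) t s

theorem norm_velocity_sq_of_circular {k : ℝ} (hr : ∀ t, HasDerivAt r (v t) t)
    (hrne : ∀ t, r t ≠ 0) (hv : ∀ t, HasDerivAt v (-(k / ‖r t‖ ^ 3) • r t) t)
    (hcirc : ∀ t, ‖r t‖ = ‖r 0‖) (t : ℝ) :
    ⟪r t, v t⟫ = 0 ∧ ‖v t‖ ^ 2 = k / ‖r t‖ := by
  have horth (t : ℝ) : ⟪r t, v t⟫ = 0 := by
    have h1 := (hr t).norm_sq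
    simp only [hcirc] at h1
    have := h1.unique (hasDerivAt_const t _)
    linarith
  refine ⟨horth t, ?_⟩
  have h1 := (hr t).inner ℝ (hv t)
  simp only [horth] at h1
  have h2 := h1.unique (hasDerivAt_const t _)
  have hpos : ‖r t‖ ≠ 0 := norm_ne_zero_iff.mpr (hrne t)
  rw [inner_smul_right, real_inner_self_eq_norm_sq, real_inner_self_eq_norm_sq] at h2
  field_simp at h2 ⊢
  linarith

end CentralForce

/-- If the energy has the critical value `-k² / (2 G)`, the radius is determined by the
squared specific angular momentum `G = ρ² u - s²`. -/
theorem radius_eq_of_critical_energy {k ρ u s G : ℝ} (hk : 0 < k) (hρ : 0 < ρ) (hG : 0 < G)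
    (hgram : ρ ^ 2 * u - s ^ 2 = G) (henergy : u / 2 - k / ρ = -k ^ 2 / (2 * G)) :
    ρ = G / k := by
  have hu : G * (ρ * u - 2 * k) = -k ^ 2 * ρ := by
    field_simp at henergy
    linarith
  have hsum : (G - k * ρ) ^ 2 + s ^ 2 * G = 0 := by
    linear_combination -G * hgram + ρ * hu
  have hsq : (G - k * ρ) ^ 2 = 0 := by
    nlinarith [sq_nonneg (G - k * ρ), mul_nonneg (sq_nonneg s) hG.le]
  rw [eq_div_iff hk.ne']
  linarith [pow_eq_zero_iff (two_ne_zero) |>.mp hsq]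

/-- Circularity condition: a negative-energy Kepler orbit with nonzero angular momentum
is circular if and only if `h = −m³k²/(2l²)`. -/
theorem kepler_circularity_condition
    (k m : ℝ) (hk : 0 < k) (hm : 0 < m)
    (r : ℝ → EuclideanSpace ℝ (Fin 3))
    (hr : Differentiable ℝ r) (hr' : Differentiable ℝ (deriv r))
    (hrne : ∀ t, r t ≠ 0)
    (heq : ∀ t, deriv (deriv r) t = -(k / ‖r t‖ ^ 3) • r t)
    (L : EuclideanSpace ℝ (Fin 3)) (hL : L = m • cross3 (r 0) (deriv r 0)) (hLne : L ≠ 0)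
    (l : ℝ) (hl : l = ‖L‖)
    (h : ℝ) (hh : h = m * ‖deriv r 0‖ ^ 2 / 2 - m * k / ‖r 0‖) (hhneg : h < 0) :
    (∀ t, ‖r t‖ = ‖r 0‖) ↔ h = -(m ^ 3 * k ^ 2) / (2 * l ^ 2) := by
  have hd (t : ℝ) : HasDerivAt r (deriv r t) t := (hr t).hasDerivAt
  have hd' (t : ℝ) : HasDerivAt (deriv r) (-(k / ‖r t‖ ^ 3) • r t) t :=
    heq t ▸ (hr' t).hasDerivAt
  have hpos (t : ℝ) : 0 < ‖r t‖ := norm_pos_iff.mpr (hrne t)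
  obtain ⟨G, hGdef⟩ : ∃ G, G = ‖r 0‖ ^ 2 * ‖deriv r 0‖ ^ 2 - ⟪r 0, deriv r 0⟫ ^ 2 := ⟨_, rfl⟩
  have hlsq : l ^ 2 = m ^ 2 * G := by
    rw [hl, hL, norm_smul, mul_pow, norm_cross3_sq, Real.norm_eq_abs, sq_abs, hGdef]
  have hG : 0 < G := by
    have hlpos : 0 < l ^ 2 := by rw [hl]; exact pow_pos (norm_pos_iff.mpr hLne) 2
    rw [hlsq] at hlpos
    exact pos_of_mul_pos_right hlpos (sq_nonneg m)
  have hcrit : h = -(m ^ 3 * k ^ 2) / (2 * l ^ 2) ↔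
      ‖deriv r 0‖ ^ 2 / 2 - k / ‖r 0‖ = -k ^ 2 / (2 * G) := by
    have hleft : m * ‖deriv r 0‖ ^ 2 / 2 - m * k / ‖r 0‖ =
        m * (‖deriv r 0‖ ^ 2 / 2 - k / ‖r 0‖) := by ring
    have hright : -(m ^ 3 * k ^ 2) / (2 * (m ^ 2 * G)) = m * (-k ^ 2 / (2 * G)) := by
      field_simp
    rw [hh, hlsq, hleft, hright, mul_right_inj' hm.ne']
  rw [hcrit]
  constructor
  · intro hcirc
    obtain ⟨horth, hspeed⟩ := norm_velocity_sq_of_circular hd hrne hd' hcirc 0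
    have hρ := (hpos 0).ne'
    rw [hGdef, horth, hspeed]
    field_simp
    ring
  · intro henergy t
    rw [radius_eq_of_critical_energy hk (hpos t) hG
        ((gram_eq_of_central_force hd hd' t 0).trans hGdef.symm)
        ((kepler_energy_eq hd hrne hd' t 0).trans henergy),
      radius_eq_of_critical_energy hk (hpos 0) hG hGdef.symm henergy]
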